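/- arXiv:1201.6616 — 2 statements merged into one kernel-verified Lean document; each statement's English description precedes it below -/
import Mathlib

section
/- With Θ the context-free grammar constructed from a confluent context-free monadic rewriting system (A,R): for all u, w ∈ A*, w ⇒*_R u if and only if $_u ⇒*_Θ w. -/
/-! Common framework: string rewriting systems and the grammar Θ constructed from a
confluent context-free monadic rewriting system `(A, R)`. -/

/-- Words over the alphabet `A`. -/
abbrev Word (A : Type) : Type := List A

/-- The word (of length at most one) corresponding to an element of `A ∪ {ε}`. -/
def toWord {A : Type} (a : Option A) : Word A := a.elim [] (fun b => [b])

/-- One rewriting step of the string rewriting system `R`. -/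
def RWStep {A : Type} (R : Set (Word A × Word A)) (u v : Word A) : Prop :=
  ∃ (x y l r : Word A), (l, r) ∈ R ∧ u = x ++ l ++ y ∧ v = x ++ r ++ y

/-- The reduction relation `⇒*_R`. -/
abbrev RWDerives {A : Type} (R : Set (Word A × Word A)) : Word A → Word A → Prop :=
  Relation.ReflTransGen (RWStep R)

/-- Equality in the monoid presented by `⟨A | R⟩`. -/
abbrev MonEq {A : Type} (R : Set (Word A × Word A)) : Word A → Word A → Prop :=
  Relation.EqvGen (RWStep R)

/-- Confluence of the rewriting system. -/
def RWConfluent {A : Type} (R : Set (Word A × Word A)) : Prop :=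
  ∀ u u' u'' : Word A, RWDerives R u u' → RWDerives R u u'' →
    ∃ v : Word A, RWDerives R u' v ∧ RWDerives R u'' v

/-- Monadic: length-reducing with right-hand sides in `A ∪ {ε}`. -/
def RWMonadic {A : Type} (R : Set (Word A × Word A)) : Prop :=
  ∀ p ∈ R, p.2.length < p.1.length ∧ p.2.length ≤ 1

/-- Terminal alphabet of the auxiliary grammar `Δ`:
the symbols `$_a`, `$̃_a` (for `a ∈ A ∪ {ε}`) together with `#₂`. -/
inductive DollarT (A : Type) : Type
  | dol : Option A → DollarT A
  | tdol : Option A → DollarT A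
  | hash : DollarT A

/-- `$_p` as a word over `DollarT A`: `$_{p₁}⋯$_{p_n}` for `p ≠ ε`,
and the single letter `$_ε` for `p = ε`. -/
def dW {A : Type} : Word A → List (DollarT A)
  | [] => [DollarT.dol none]
  | p => p.map (fun b => DollarT.dol (some b))

/-- `$̃_p` as a word over `DollarT A`. -/
def tdW {A : Type} : Word A → List (DollarT A)
  | [] => [DollarT.tdol none]
  | p => p.map (fun b => DollarT.tdol (some b))

/-- Nonterminals of `Θ`: the nonterminals of `Δ`, the symbols `$_a` and `$̃_a`
(`a ∈ A ∪ {ε}`), and the (pairwise disjoint) nonterminals of the grammars `Γ'_a`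
and `Γ''_a`. -/
inductive ThetaNT (A : Type) (Γ : Option A → ContextFreeGrammar.{0} A)
    (Δ : ContextFreeGrammar.{0} (DollarT A)) : Type
  | delta : Δ.NT → ThetaNT A Γ Δ
  | dol : Option A → ThetaNT A Γ Δ
  | tdol : Option A → ThetaNT A Γ Δ
  | prime : (a : Option A) → (Γ a).NT → ThetaNT A Γ Δ
  | dprime : (a : Option A) → (Γ a).NT → ThetaNT A Γ Δ

variable {A : Type} (Γ : Option A → ContextFreeGrammar.{0} A)
  (Δ : ContextFreeGrammar.{0} (DollarT A))

/-- Translation of symbols of `Γ_a` into symbols of `Θ`, realising `Γ'_a`: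
each terminal `b` is replaced by the nonterminal `$_b`. -/
def primeSym (a : Option A) : Symbol A (Γ a).NT → Symbol (Option A) (ThetaNT A Γ Δ)
  | Symbol.terminal b => Symbol.nonterminal (ThetaNT.dol (some b))
  | Symbol.nonterminal n => Symbol.nonterminal (ThetaNT.prime a n)

/-- Translation of symbols of `Γ_a` into symbols of `Θ`, realising `Γ''_a`:
each terminal `b` is replaced by the nonterminal `$̃_b`. -/
def dprimeSym (a : Option A) : Symbol A (Γ a).NT → Symbol (Option A) (ThetaNT A Γ Δ)
  | Symbol.terminal b => Symbol.nonterminal (ThetaNT.tdol (some b))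
  | Symbol.nonterminal n => Symbol.nonterminal (ThetaNT.dprime a n)

/-- Translation of symbols of `Δ` into symbols of `Θ`: the terminals `$_a`, `$̃_a`
of `Δ` become nonterminals of `Θ`, and `#₂` stays a terminal (encoded as `none`). -/
def deltaSym : Symbol (DollarT A) Δ.NT → Symbol (Option A) (ThetaNT A Γ Δ)
  | Symbol.terminal (DollarT.dol a) => Symbol.nonterminal (ThetaNT.dol a)
  | Symbol.terminal (DollarT.tdol a) => Symbol.nonterminal (ThetaNT.tdol a)
  | Symbol.terminal DollarT.hash => Symbol.terminal none
  | Symbol.nonterminal n => Symbol.nonterminal (ThetaNT.delta n)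

/-- The productions of `Θ`: those of `Δ`, those of all `Γ'_a` and `Γ''_a`, the insertion
productions `$_a → $_a $_ε`, `$_a → $_ε $_a`, `$̃_a → $̃_a $̃_ε`, `$̃_a → $̃_ε $̃_a`, the
start productions `$_a → O'_a`, `$̃_a → O''_a`, and the terminal productions
`$_a → a`, `$̃_a → a` (with `$_ε → ε`, `$̃_ε → ε`). -/
noncomputable def thetaRules [Fintype A] : List (ContextFreeRule (Option A) (ThetaNT A Γ Δ)) :=
  (Δ.rules.toList.map (fun r =>
    ⟨ThetaNT.delta r.input, r.output.map (deltaSym Γ Δ)⟩))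
  ++ ((Finset.univ : Finset (Option A)).toList.flatMap (fun a =>
      ((Γ a).rules.toList.map (fun r =>
        ⟨ThetaNT.prime a r.input, r.output.map (primeSym Γ Δ a)⟩))
      ++ ((Γ a).rules.toList.map (fun r =>
        ⟨ThetaNT.dprime a r.input, r.output.reverse.map (dprimeSym Γ Δ a)⟩))
      ++ [⟨ThetaNT.dol a, [Symbol.nonterminal (ThetaNT.dol a),
             Symbol.nonterminal (ThetaNT.dol none)]⟩,
          ⟨ThetaNT.dol a, [Symbol.nonterminal (ThetaNT.dol none),
             Symbol.nonterminal (ThetaNT.dol a)]⟩,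
          ⟨ThetaNT.tdol a, [Symbol.nonterminal (ThetaNT.tdol a),
             Symbol.nonterminal (ThetaNT.tdol none)]⟩,
          ⟨ThetaNT.tdol a, [Symbol.nonterminal (ThetaNT.tdol none),
             Symbol.nonterminal (ThetaNT.tdol a)]⟩,
          ⟨ThetaNT.dol a, [Symbol.nonterminal (ThetaNT.prime a (Γ a).initial)]⟩,
          ⟨ThetaNT.tdol a, [Symbol.nonterminal (ThetaNT.dprime a (Γ a).initial)]⟩,
          ⟨ThetaNT.dol a, (toWord a).map (fun b => Symbol.terminal (some b))⟩,
          ⟨ThetaNT.tdol a, (toWord a).map (fun b => Symbol.terminal (some b))⟩]))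

/-- The grammar `Θ`, over the terminal alphabet `A ∪ {#₂}` (encoded as `Option A`
with `none = #₂`), with start symbol `O_Δ`. -/
noncomputable def Theta [Fintype A] : ContextFreeGrammar.{0} (Option A) :=
  { NT := ThetaNT A Γ Δ
    initial := ThetaNT.delta Δ.initial
    rules := @List.toFinset _ (Classical.decEq _) (thetaRules Γ Δ) }

/-- `$_p` as a string of symbols of `Θ` (the single letter `$_ε` when `p = ε`). -/
def dols : Word A → List (Symbol (Option A) (ThetaNT A Γ Δ))
  | [] => [Symbol.nonterminal (ThetaNT.dol none)]
  | p => p.map (fun b => Symbol.nonterminal (ThetaNT.dol (some b)))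

/-- `$̃_p` as a string of symbols of `Θ` (the single letter `$̃_ε` when `p = ε`). -/
def tdols : Word A → List (Symbol (Option A) (ThetaNT A Γ Δ))
  | [] => [Symbol.nonterminal (ThetaNT.tdol none)]
  | p => p.map (fun b => Symbol.nonterminal (ThetaNT.tdol (some b)))

/-- A word over `A` as a string of terminal symbols of `Θ`. -/
def terms : Word A → List (Symbol (Option A) (ThetaNT A Γ Δ)) :=
  fun u => u.map (fun b => Symbol.terminal (some b))

namespace RWStep

variable {R : Set (Word A × Word A)} {u v : Word A}

lemma append_context (h : RWStep R u v) (p q : Word A) :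
    RWStep R (p ++ u ++ q) (p ++ v ++ q) := by
  obtain ⟨x, y, l, r, hr, rfl, rfl⟩ := h
  exact ⟨p ++ x, y ++ q, l, r, hr, by simp, by simp⟩

end RWStep

lemma RWDerives.append_context {R : Set (Word A × Word A)} {u v : Word A}
    (h : RWDerives R u v) (p q : Word A) : RWDerives R (p ++ u ++ q) (p ++ v ++ q) :=
  h.lift (fun z => p ++ z ++ q) fun _ _ hs => hs.append_context p q

namespace ContextFreeGrammar

/-- The words generated by a single symbol of a grammar. -/
def symbolLanguage (g : ContextFreeGrammar.{0} A) (s : Symbol A g.NT) : Language A :=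
  {z | g.Derives [s] (z.map Symbol.terminal)}

lemma derives_of_mem_prod_symbolLanguage (g : ContextFreeGrammar.{0} A) :
    ∀ (s : List (Symbol A g.NT)) (z : List A),
      z ∈ (s.map g.symbolLanguage).prod → g.Derives s (z.map Symbol.terminal)
  | [], z, hz => by
    have : z = [] := by simpa [Language.mem_one] using hz
    subst this
    exact .refl _
  | x :: s, z, hz => by
    rw [List.map_cons, List.prod_cons] at hz
    obtain ⟨z₁, h₁, z₂, h₂, rfl⟩ := Language.mem_mul.1 hz
    rw [List.map_append]
    have h₁ : g.Derives [x] (z₁.map Symbol.terminal) := h₁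
    exact (h₁.append_right s).trans
      ((derives_of_mem_prod_symbolLanguage g s z₂ h₂).append_left _)

end ContextFreeGrammar

section Productions

variable [Fintype A]

/-- One derivation step of `Θ`, on strings over the concrete type of nonterminals. -/
def ThetaStep (s t : List (Symbol (Option A) (ThetaNT A Γ Δ))) : Prop :=
  ∃ r ∈ thetaRules Γ Δ, r.Rewrites s t

/-- The relation `⇒*_Θ`, on strings over the concrete type of nonterminals. -/
abbrev ThetaDerives : List (Symbol (Option A) (ThetaNT A Γ Δ)) →
    List (Symbol (Option A) (ThetaNT A Γ Δ)) → Prop :=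
  Relation.ReflTransGen (ThetaStep Γ Δ)

lemma Theta_produces_iff {s t : List (Symbol (Option A) (ThetaNT A Γ Δ))} :
    (Theta Γ Δ).Produces s t ↔ ThetaStep Γ Δ s t :=
  exists_congr fun _ => and_congr_left' (@List.mem_toFinset _ (Classical.decEq _) _ _)

lemma Theta_derives_iff {s t : List (Symbol (Option A) (ThetaNT A Γ Δ))} :
    (Theta Γ Δ).Derives s t ↔ ThetaDerives Γ Δ s t :=
  ⟨fun h => h.lift id fun _ _ => (Theta_produces_iff Γ Δ).1,
    fun h => h.lift id fun _ _ => (Theta_produces_iff Γ Δ).2⟩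

variable {Γ Δ} in
lemma ThetaDerives.append_context {s t : List (Symbol (Option A) (ThetaNT A Γ Δ))}
    (h : ThetaDerives Γ Δ s t) (p q : List (Symbol (Option A) (ThetaNT A Γ Δ))) :
    ThetaDerives Γ Δ (p ++ s ++ q) (p ++ t ++ q) :=
  h.lift (fun z => p ++ z ++ q) fun _ _ ⟨r, hr, hrw⟩ =>
    ⟨r, hr, (hrw.append_left p).append_right q⟩

variable {Γ Δ} in
lemma ThetaDerives.output {r : ContextFreeRule (Option A) (ThetaNT A Γ Δ)}
    (hr : r ∈ thetaRules Γ Δ) : ThetaDerives Γ Δ [Symbol.nonterminal r.input] r.output :=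
  .single ⟨r, hr, ContextFreeRule.Rewrites.input_output⟩

lemma Theta_derives_insert_right (a : Option A) :
    ThetaDerives Γ Δ [Symbol.nonterminal (ThetaNT.dol a)]
      [Symbol.nonterminal (ThetaNT.dol a), Symbol.nonterminal (ThetaNT.dol none)] :=
  .output (r := ⟨ThetaNT.dol a, _⟩) <| List.mem_append_right _ <|
    List.mem_flatMap.2 ⟨a, by simp, List.mem_append_right _ (by simp)⟩

lemma Theta_derives_insert_left (a : Option A) :
    ThetaDerives Γ Δ [Symbol.nonterminal (ThetaNT.dol a)]
      [Symbol.nonterminal (ThetaNT.dol none), Symbol.nonterminal (ThetaNT.dol a)] :=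
  .output (r := ⟨ThetaNT.dol a, _⟩) <| List.mem_append_right _ <|
    List.mem_flatMap.2 ⟨a, by simp, List.mem_append_right _ (by simp)⟩

lemma Theta_derives_start (a : Option A) :
    ThetaDerives Γ Δ [Symbol.nonterminal (ThetaNT.dol a)]
      [Symbol.nonterminal (ThetaNT.prime a (Γ a).initial)] :=
  .output (r := ⟨ThetaNT.dol a, _⟩) <| List.mem_append_right _ <|
    List.mem_flatMap.2 ⟨a, by simp, List.mem_append_right _ (by simp)⟩

lemma Theta_derives_toWord (a : Option A) :
    ThetaDerives Γ Δ [Symbol.nonterminal (ThetaNT.dol a)]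
      (terms Γ Δ (toWord a)) :=
  .output (r := ⟨ThetaNT.dol a, _⟩) <| List.mem_append_right _ <|
    List.mem_flatMap.2 ⟨a, by simp, List.mem_append_right _ (by simp)⟩

lemma Theta_derives_map_primeSym (a : Option A) {s t : List (Symbol A (Γ a).NT)}
    (h : (Γ a).Derives s t) :
    ThetaDerives Γ Δ (s.map (primeSym Γ Δ a)) (t.map (primeSym Γ Δ a)) := by
  refine h.lift (List.map (primeSym Γ Δ a)) ?_
  rintro s t ⟨r, hr, hrw⟩
  obtain ⟨p, q, rfl, rfl⟩ := hrw.exists_parts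
  refine ⟨⟨ThetaNT.prime a r.input, r.output.map (primeSym Γ Δ a)⟩, ?_, ?_⟩
  · refine List.mem_append_right _ (List.mem_flatMap.2 ⟨a, by simp, ?_⟩)
    exact List.mem_append_left _ (List.mem_append_left _
      (List.mem_map.2 ⟨r, by simpa using hr, rfl⟩))
  · rw [ContextFreeRule.rewrites_iff]
    exact ⟨p.map (primeSym Γ Δ a), q.map (primeSym Γ Δ a), by simp [primeSym], by simp⟩

end Productions

/-- The symbols `$_b` for the letters `b` of a word, the empty word giving the empty string. -/
def letterDols (w : Word A) : List (Symbol (Option A) (ThetaNT A Γ Δ)) :=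
  w.map fun b => Symbol.nonterminal (ThetaNT.dol (some b))

lemma dols_of_ne_nil {w : Word A} (hw : w ≠ []) : dols Γ Δ w = letterDols Γ Δ w := by
  cases w with
  | nil => exact absurd rfl hw
  | cons b w => rfl

section Completeness

variable [Fintype A] {R : Set (Word A × Word A)}

lemma dols_derives_insert (x y : Word A) :
    ThetaDerives Γ Δ (dols Γ Δ (x ++ y))
      (letterDols Γ Δ x ++ [Symbol.nonterminal (ThetaNT.dol none)] ++ letterDols Γ Δ y) := by
  cases y with
  | cons b y =>
    rw [dols_of_ne_nil Γ Δ (by simp)]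
    have h := (Theta_derives_insert_left Γ Δ (some b)).append_context
      (letterDols Γ Δ x) (letterDols Γ Δ y)
    simpa [letterDols] using h
  | nil =>
    rcases List.eq_nil_or_concat x with rfl | ⟨x, b, rfl⟩
    · exact .refl
    · rw [dols_of_ne_nil Γ Δ (by simp)]
      have h := (Theta_derives_insert_right Γ Δ (some b)).append_context (letterDols Γ Δ x) []
      simpa [letterDols] using h

lemma dols_derives_replace (x y : Word A) (a : Option A) :
    ThetaDerives Γ Δ (dols Γ Δ (x ++ toWord a ++ y))
      (letterDols Γ Δ x ++ [Symbol.nonterminal (ThetaNT.dol a)] ++ letterDols Γ Δ y) := by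
  cases a with
  | none => simpa [toWord] using dols_derives_insert Γ Δ x y
  | some a =>
    rw [dols_of_ne_nil Γ Δ (by simp [toWord])]
    simpa [toWord, letterDols] using Relation.ReflTransGen.refl

lemma dol_derives_letterDols {a : Option A} {l : Word A} (hl : l ∈ (Γ a).language) :
    ThetaDerives Γ Δ [Symbol.nonterminal (ThetaNT.dol a)] (letterDols Γ Δ l) := by
  have h := Theta_derives_map_primeSym Γ Δ a hl
  simp only [List.map_cons, List.map_nil, List.map_map] at h
  exact (Theta_derives_start Γ Δ a).trans h

lemma RWStep.dols_derives
    (hmon : RWMonadic R)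
    (hΓ : ∀ a : Option A, (Γ a).language = {l : Word A | (l, toWord a) ∈ R})
    {w v : Word A} (h : RWStep R w v) :
    ThetaDerives Γ Δ (dols Γ Δ v) (dols Γ Δ w) := by
  obtain ⟨x, y, l, r, hr, rfl, rfl⟩ := h
  obtain ⟨hlt, hle⟩ := hmon _ hr
  have hl : l ≠ [] := by rintro rfl; simp at hlt
  obtain ⟨a, rfl⟩ : ∃ a : Option A, r = toWord a := by
    match r, hle with
    | [], _ => exact ⟨none, rfl⟩
    | [b], _ => exact ⟨some b, rfl⟩
  have hla : l ∈ (Γ a).language := by rw [hΓ]; exact hr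
  refine (dols_derives_replace Γ Δ x y a).trans ?_
  rw [dols_of_ne_nil Γ Δ (by simp [hl])]
  have h := (dol_derives_letterDols Γ Δ hla).append_context (letterDols Γ Δ x)
    (letterDols Γ Δ y)
  simpa [letterDols] using h

lemma letterDols_derives_terms (w : Word A) :
    ThetaDerives Γ Δ (letterDols Γ Δ w) (terms Γ Δ w) := by
  induction w with
  | nil => exact .refl
  | cons b w ih =>
    have h₁ := (Theta_derives_toWord Γ Δ (some b)).append_context [] (letterDols Γ Δ w)
    have h₂ := ih.append_context (terms Γ Δ [b]) []
    rw [List.append_nil, List.append_nil] at h₂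
    exact h₁.trans h₂

lemma dols_derives_terms (w : Word A) :
    ThetaDerives Γ Δ (dols Γ Δ w) (terms Γ Δ w) := by
  cases w with
  | nil => exact Theta_derives_toWord Γ Δ none
  | cons b w => exact letterDols_derives_terms Γ Δ (b :: w)

end Completeness

/-- The words over `A` denoted by a symbol of `Θ`: `$_a` denotes `a`, a nonterminal of `Γ'_a`
denotes what it generates in `Γ_a`, and the symbols which cannot be reached from the `$_a`
denote every word. -/
def denotation : Symbol (Option A) (ThetaNT A Γ Δ) → Language A
  | Symbol.terminal (some b) => {[b]}
  | Symbol.nonterminal (ThetaNT.dol a) => {toWord a}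
  | Symbol.nonterminal (ThetaNT.prime a n) => (Γ a).symbolLanguage (Symbol.nonterminal n)
  | _ => Set.univ

/-- The words denoted by a string of symbols of `Θ`. -/
def stringDenotation (s : List (Symbol (Option A) (ThetaNT A Γ Δ))) : Language A :=
  (s.map (denotation Γ Δ)).prod

lemma stringDenotation_append (s t : List (Symbol (Option A) (ThetaNT A Γ Δ))) :
    stringDenotation Γ Δ (s ++ t) = stringDenotation Γ Δ s * stringDenotation Γ Δ t := by
  simp [stringDenotation]

lemma stringDenotation_singleton (x : Symbol (Option A) (ThetaNT A Γ Δ)) :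
    stringDenotation Γ Δ [x] = denotation Γ Δ x := by
  simp [stringDenotation]

lemma mem_stringDenotation_terms {w z : Word A} :
    z ∈ stringDenotation Γ Δ (terms Γ Δ w) ↔ z = w := by
  induction w generalizing z with
  | nil => simp [stringDenotation, terms, Language.mem_one]
  | cons b w ih =>
    have : stringDenotation Γ Δ (terms Γ Δ (b :: w))
        = ({[b]} : Language A) * stringDenotation Γ Δ (terms Γ Δ w) := rfl
    rw [this]
    refine Language.mem_mul.trans ?_
    simp only [ih]
    constructor
    · rintro ⟨_, rfl, _, rfl, rfl⟩
      rfl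
    · rintro rfl
      exact ⟨[b], rfl, w, rfl, rfl⟩

lemma mem_stringDenotation_dol {a : Option A} {z : Word A} :
    z ∈ stringDenotation Γ Δ [Symbol.nonterminal (ThetaNT.dol a)] ↔ z = toWord a := by
  rw [stringDenotation_singleton]
  exact Iff.rfl

lemma stringDenotation_dols (w : Word A) :
    stringDenotation Γ Δ (dols Γ Δ w) = stringDenotation Γ Δ (terms Γ Δ w) := by
  cases w with
  | nil =>
    ext z
    rw [mem_stringDenotation_terms]
    exact mem_stringDenotation_dol Γ Δ
  | cons b w =>
    simp only [stringDenotation, dols, terms, List.map_map]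
    rfl

lemma denotation_primeSym (a : Option A) (s : List (Symbol A (Γ a).NT)) {z : Word A}
    (hz : z ∈ stringDenotation Γ Δ (s.map (primeSym Γ Δ a))) :
    z ∈ (s.map (Γ a).symbolLanguage).prod := by
  induction s generalizing z with
  | nil => exact hz
  | cons x s ih =>
    obtain ⟨z₁, h₁, z₂, h₂, rfl⟩ := Language.mem_mul.1 hz
    refine Language.mem_mul.2 ⟨z₁, ?_, z₂, ih h₂, rfl⟩
    cases x with
    | nonterminal n => exact h₁
    | terminal b =>
      have h₁ : z₁ = [b] := h₁
      subst h₁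
      exact ContextFreeGrammar.Derives.refl _

section Soundness

variable [Fintype A] {R : Set (Word A × Word A)}

lemma exists_denotation_of_mem_thetaRules
    (hΓ : ∀ a : Option A, (Γ a).language = {l : Word A | (l, toWord a) ∈ R})
    {r : ContextFreeRule (Option A) (ThetaNT A Γ Δ)} (hr : r ∈ thetaRules Γ Δ)
    {z : Word A} (hz : z ∈ stringDenotation Γ Δ r.output) :
    ∃ z' ∈ denotation Γ Δ (Symbol.nonterminal r.input), RWDerives R z z' := by
  rcases List.mem_append.1 hr with hr | hr
  · obtain ⟨q, -, rfl⟩ := List.mem_map.1 hr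
    exact ⟨z, Set.mem_univ z, .refl⟩
  obtain ⟨a, -, hr⟩ := List.mem_flatMap.1 hr
  rcases List.mem_append.1 hr with hr | hr
  · rcases List.mem_append.1 hr with hr | hr
    · obtain ⟨q, hq, rfl⟩ := List.mem_map.1 hr
      refine ⟨z, ?_, .refl⟩
      have h := (Γ a).derives_of_mem_prod_symbolLanguage _ _ (denotation_primeSym Γ Δ a _ hz)
      exact ContextFreeGrammar.Produces.trans_derives
        ⟨q, by simpa using hq, ContextFreeRule.Rewrites.input_output⟩ h
    · obtain ⟨q, -, rfl⟩ := List.mem_map.1 hr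
      exact ⟨z, Set.mem_univ z, .refl⟩
  simp only [List.mem_cons, List.not_mem_nil, or_false] at hr
  rcases hr with rfl | rfl | rfl | rfl | rfl | rfl | rfl | rfl
  · rw [← List.singleton_append, stringDenotation_append] at hz
    obtain ⟨z₁, h₁, z₂, h₂, rfl⟩ := Language.mem_mul.1 hz
    rw [mem_stringDenotation_dol] at h₁ h₂
    subst h₁ h₂
    exact ⟨_, List.append_nil _, .refl⟩
  · rw [← List.singleton_append, stringDenotation_append] at hz
    obtain ⟨z₁, h₁, z₂, h₂, rfl⟩ := Language.mem_mul.1 hz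
    rw [mem_stringDenotation_dol] at h₁ h₂
    subst h₁ h₂
    exact ⟨_, rfl, .refl⟩
  · exact ⟨z, Set.mem_univ z, .refl⟩
  · exact ⟨z, Set.mem_univ z, .refl⟩
  · refine ⟨toWord a, rfl, .single ⟨[], [], z, toWord a, ?_, by simp, by simp⟩⟩
    rw [stringDenotation_singleton] at hz
    have h : z ∈ (Γ a).language := hz
    rw [hΓ] at h
    exact h
  · exact ⟨z, Set.mem_univ z, .refl⟩
  · have hz : z ∈ stringDenotation Γ Δ (terms Γ Δ (toWord a)) := hz
    rw [mem_stringDenotation_terms] at hz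
    exact ⟨z, hz, .refl⟩
  · exact ⟨z, Set.mem_univ z, .refl⟩

lemma exists_mem_stringDenotation_of_derives
    (hΓ : ∀ a : Option A, (Γ a).language = {l : Word A | (l, toWord a) ∈ R})
    {s : List (Symbol (Option A) (ThetaNT A Γ Δ))} {w : Word A}
    (h : ThetaDerives Γ Δ s (terms Γ Δ w)) :
    ∃ v ∈ stringDenotation Γ Δ s, RWDerives R w v := by
  induction h using Relation.ReflTransGen.head_induction_on with
  | refl => exact ⟨w, (mem_stringDenotation_terms Γ Δ).2 rfl, .refl⟩
  | head hst _ ih =>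
    obtain ⟨r, hr, hrw⟩ := hst
    obtain ⟨p, q, rfl, rfl⟩ := hrw.exists_parts
    obtain ⟨v, hv, hwv⟩ := ih
    rw [stringDenotation_append, stringDenotation_append] at hv
    obtain ⟨_, hv₁, z₃, h₃, rfl⟩ := Language.mem_mul.1 hv
    obtain ⟨z₁, h₁, z₂, h₂, rfl⟩ := Language.mem_mul.1 hv₁
    obtain ⟨z, hz, hd⟩ := exists_denotation_of_mem_thetaRules Γ Δ hΓ
      hr h₂
    refine ⟨z₁ ++ z ++ z₃, ?_, hwv.trans (hd.append_context z₁ z₃)⟩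
    rw [stringDenotation_append, stringDenotation_append]
    refine Language.append_mem_mul (Language.append_mem_mul h₁ ?_) h₃
    rwa [stringDenotation_singleton]

end Soundness

/-- **Lemma 3.5.** For all `u, w ∈ A*`, `w ⇒*_R u` if and only if `$_u ⇒*_Θ w`. -/
theorem rwDerives_iff_derives_terms
    {A : Type} [Fintype A] (R : Set (Word A × Word A))
    (hconf : RWConfluent R) (hmon : RWMonadic R)
    (Γ : Option A → ContextFreeGrammar.{0} A)
    (hΓ : ∀ a : Option A, (Γ a).language = {l : Word A | (l, toWord a) ∈ R})
    (hΓeps : ∀ a : Option A, ∀ r ∈ (Γ a).rules, r.output ≠ [])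
    (Δ : ContextFreeGrammar.{0} (DollarT A))
    (hΔ : Δ.language =
      {x | ∃ p : Word A, x = dW p ++ [DollarT.hash] ++ tdW p.reverse}) :
    ∀ u w : Word A,
      RWDerives R w u ↔ (Theta Γ Δ).Derives (dols Γ Δ u) (terms Γ Δ w) := by
  intro u w
  refine Iff.trans ?_ (Theta_derives_iff Γ Δ).symm
  constructor
  · intro h
    refine Relation.ReflTransGen.trans ?_ (dols_derives_terms Γ Δ w)
    induction h using Relation.ReflTransGen.head_induction_on with
    | refl => exact .refl
    | head hs _ ih => exact ih.trans (hs.dols_derives Γ Δ hmon hΓ)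
  · intro h
    obtain ⟨v, hv, hwv⟩ := exists_mem_stringDenotation_of_derives Γ Δ hΓ h
    rw [stringDenotation_dols, mem_stringDenotation_terms] at hv
    exact hv ▸ hwv
end

section
/- With Θ the context-free grammar constructed from a confluent context-free monadic rewriting system (A,R) presenting a monoid M: the language generated by Θ equals K = { u #₂ vʳᵉᵛ : u, v ∈ A*, u =_M v }. In particular, K is context-free. -/
variable {A : Type} (Γ : Option A → ContextFreeGrammar.{0} A)
  (Δ : ContextFreeGrammar.{0} (DollarT A))

section Presentation

variable {A : Type} {R : Set (Word A × Word A)}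

lemma RWStep.append_left {u v : Word A} (h : RWStep R u v) (w : Word A) :
    RWStep R (w ++ u) (w ++ v) := by
  obtain ⟨x, y, l, r, hr, rfl, rfl⟩ := h
  exact ⟨w ++ x, y, l, r, hr, by simp, by simp⟩

lemma RWStep.append_right {u v : Word A} (h : RWStep R u v) (w : Word A) :
    RWStep R (u ++ w) (v ++ w) := by
  obtain ⟨x, y, l, r, hr, rfl, rfl⟩ := h
  exact ⟨x, y ++ w, l, r, hr, by simp, by simp⟩

lemma RWStep.of_mem {l r : Word A} (h : (l, r) ∈ R) : RWStep R l r :=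
  ⟨[], [], l, r, h, by simp, by simp⟩

lemma RWDerives.append {u u' v v' : Word A} (hu : RWDerives R u u') (hv : RWDerives R v v') :
    RWDerives R (u ++ v) (u' ++ v') :=
  (Relation.ReflTransGen.lift (p := RWStep R) (· ++ v)
      (fun _ _ (h : RWStep R _ _) => h.append_right v) _ _ hu).trans
    (Relation.ReflTransGen.lift (p := RWStep R) (u' ++ ·)
      (fun _ _ (h : RWStep R _ _) => h.append_left u') _ _ hv)

lemma RWDerives.monEq {u v : Word A} (h : RWDerives R u v) : MonEq R u v := by
  induction h with
  | refl => exact .refl _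
  | tail _ h ih => exact ih.trans _ _ _ (.rel _ _ h)

/-- The Church–Rosser property. -/
lemma RWConfluent.exists_common (hR : RWConfluent R) {u v : Word A} (h : MonEq R u v) :
    ∃ p, RWDerives R u p ∧ RWDerives R v p := by
  induction h with
  | rel u v h => exact ⟨v, .single h, .refl⟩
  | refl u => exact ⟨u, .refl, .refl⟩
  | symm _ _ _ ih => exact ih.imp fun _ => And.symm
  | trans _ v _ _ _ ih₁ ih₂ =>
    obtain ⟨p, hup, hvp⟩ := ih₁
    obtain ⟨q, hvq, hwq⟩ := ih₂
    obtain ⟨s, hps, hqs⟩ := hR v p q hvp hvq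
    exact ⟨s, hup.trans hps, hwq.trans hqs⟩

/-- The rewriting system obtained by reversing both sides of every rule. -/
def reverseSystem (R : Set (Word A × Word A)) : Set (Word A × Word A) :=
  {q | (q.1.reverse, q.2.reverse) ∈ R}

lemma RWStep.reverse {u v : Word A} (h : RWStep R u v) :
    RWStep (reverseSystem R) u.reverse v.reverse := by
  obtain ⟨x, y, l, r, hr, rfl, rfl⟩ := h
  exact ⟨y.reverse, x.reverse, l.reverse, r.reverse, by simpa [reverseSystem], by simp, by simp⟩

lemma RWDerives.reverse {u v : Word A} (h : RWDerives R u v) :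
    RWDerives (reverseSystem R) u.reverse v.reverse :=
  Relation.ReflTransGen.lift (p := RWStep (reverseSystem R)) List.reverse
    (fun _ _ (h : RWStep R _ _) => h.reverse) _ _ h

lemma reverseSystem_reverseSystem (R : Set (Word A × Word A)) :
    reverseSystem (reverseSystem R) = R := by
  ext ⟨l, r⟩
  simp [reverseSystem]

lemma reverse_toWord (a : Option A) : (toWord a).reverse = toWord a := by
  cases a <;> rfl

lemma exists_eq_toWord {r : Word A} (hr : r.length ≤ 1) : ∃ a, r = toWord a := by
  match r, hr with
  | [], _ => exact ⟨none, rfl⟩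
  | [b], _ => exact ⟨some b, rfl⟩

lemma RWMonadic.reverseSystem (hR : RWMonadic R) : RWMonadic (reverseSystem R) := by
  intro q hq
  simpa using hR _ hq

end Presentation

namespace ContextFreeGrammar

variable {S T : Type*}

lemma Derives.append {g : ContextFreeGrammar T} {s s' t t' : List (Symbol T g.NT)}
    (hs : g.Derives s s') (ht : g.Derives t t') : g.Derives (s ++ t) (s' ++ t') :=
  (hs.append_right t).trans (ht.append_left s')

lemma derives_of_mem_rules {g : ContextFreeGrammar T} {r : ContextFreeRule T g.NT}
    (hr : r ∈ g.rules) : g.Derives [.nonterminal r.input] r.output :=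
  Produces.single ⟨r, hr, .input_output⟩

lemma derives_flatMap {g : ContextFreeGrammar T} {α : Type*} {F G : α → List (Symbol T g.NT)}
    (h : ∀ a, g.Derives (F a) (G a)) (s : List α) :
    g.Derives (s.flatMap F) (s.flatMap G) := by
  induction s with
  | nil => rfl
  | cons a s ih => simpa using (h a).append ih

/-- A map on symbols which turns every rule of a grammar into a derivation of another
grammar turns all derivations of the former into derivations of the latter. -/
lemma Derives.map_symbols {g : ContextFreeGrammar S} {g' : ContextFreeGrammar T}
    {F : Symbol S g.NT → Symbol T g'.NT}
    (hF : ∀ r ∈ g.rules, g'.Derives [F (.nonterminal r.input)] (r.output.map F))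
    {s t : List (Symbol S g.NT)} (h : g.Derives s t) : g'.Derives (s.map F) (t.map F) := by
  induction h with
  | refl => rfl
  | tail _ h ih =>
    obtain ⟨r, hr, hrw⟩ := h
    obtain ⟨p, q, rfl, rfl⟩ := hrw.exists_parts
    refine ih.trans ?_
    simpa using ((hF r hr).append_left (p.map F)).append_right (q.map F)

/-- If an assignment of languages to symbols is closed under all rules, then it is
decreasing along derivations. -/
lemma Derives.prod_le {g : ContextFreeGrammar T} {I : Symbol T g.NT → Language S}
    (hI : ∀ r ∈ g.rules, (r.output.map I).prod ≤ I (.nonterminal r.input))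
    {s t : List (Symbol T g.NT)} (h : g.Derives s t) : (t.map I).prod ≤ (s.map I).prod := by
  induction h with
  | refl => rfl
  | tail _ h ih =>
    obtain ⟨r, hr, hrw⟩ := h
    obtain ⟨p, q, rfl, rfl⟩ := hrw.exists_parts
    refine le_trans ?_ ih
    simp only [List.map_append, List.prod_append, List.map_cons, List.map_nil, List.prod_cons,
      List.prod_nil, mul_one]
    gcongr
    exact hI r hr

/-- The languages generated by the symbols of `g` after substituting
the language `J b` for each terminal `b`. -/
def substLanguage (g : ContextFreeGrammar T) (J : T → Language S) : Symbol T g.NT → Language S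
  | .terminal b => J b
  | .nonterminal n =>
    {x | ∃ y : List T, g.Derives [.nonterminal n] (y.map .terminal) ∧ x ∈ (y.map J).prod}

lemma exists_of_mem_prod_substLanguage {g : ContextFreeGrammar T} {J : T → Language S}
    {s : List (Symbol T g.NT)} {x : List S} (hx : x ∈ (s.map (g.substLanguage J)).prod) :
    ∃ y : List T, g.Derives s (y.map .terminal) ∧ x ∈ (y.map J).prod := by
  induction s generalizing x with
  | nil => exact ⟨[], by rfl, by simpa using hx⟩
  | cons a s ih =>
    rw [List.map_cons, List.prod_cons] at hx
    obtain ⟨x₁, hx₁, x₂, hx₂, rfl⟩ := Language.mem_mul.1 hx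
    obtain ⟨y₂, hs, hy₂⟩ := ih hx₂
    obtain ⟨y₁, ha, hy₁⟩ : ∃ y : List T, g.Derives [a] (y.map .terminal) ∧
        x₁ ∈ (y.map J).prod := by
      cases a with
      | terminal b => exact ⟨[b], by rfl, by simpa [substLanguage] using hx₁⟩
      | nonterminal n => exact hx₁
    refine ⟨y₁ ++ y₂, by simpa using ha.append hs, ?_⟩
    rw [List.map_append, List.prod_append]
    exact Language.append_mem_mul hy₁ hy₂

lemma prod_substLanguage_le (g : ContextFreeGrammar T) (J : T → Language S)
    {r : ContextFreeRule T g.NT} (hr : r ∈ g.rules) :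
    (r.output.map (g.substLanguage J)).prod ≤ g.substLanguage J (.nonterminal r.input) := by
  intro x hx
  obtain ⟨y, hy, hxy⟩ := exists_of_mem_prod_substLanguage hx
  exact ⟨y, (derives_of_mem_rules hr).trans hy, hxy⟩

lemma mem_prod_terminal (N : Type*) (I : Symbol T N → Language T)
    (hI : ∀ b, I (.terminal b) = {[b]}) (w : List T) :
    w ∈ ((w.map Symbol.terminal).map I).prod := by
  induction w with
  | nil => simp
  | cons b w ih =>
    rw [List.map_cons, List.map_cons, List.prod_cons, hI]
    exact Language.append_mem_mul (a := [b]) rfl ih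

end ContextFreeGrammar

section Completeness

variable {A T : Type} {R : Set (Word A × Word A)} {g : ContextFreeGrammar T}

/-- The word `D_p`, the single letter `D_ε` for `p = ε`. -/
def markers (f : Option A → T) : Word A → List T
  | [] => [f none]
  | p => p.map fun b => f (some b)

lemma markers_of_ne_nil (f : Option A → T) {p : Word A} (hp : p ≠ []) :
    markers f p = p.map fun b => f (some b) := by
  cases p
  · contradiction
  · rfl

lemma map_markers {T' : Type} (F : T → T') (f : Option A → T) (p : Word A) :
    (markers f p).map F = markers (F ∘ f) p := by
  cases p <;> simp [markers]

/-- Reading a rewriting step backwards: `D_v` derives `D_u` whenever `u → v`. -/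
lemma derives_markers_of_rwStep {D : Option A → Symbol T g.NT} (hmon : RWMonadic R)
    (hright : ∀ a, g.Derives [D a] [D a, D none])
    (hleft : ∀ a, g.Derives [D a] [D none, D a])
    (hrule : ∀ a l, (l, toWord a) ∈ R → g.Derives [D a] (l.map fun b => D (some b)))
    {u v : Word A} (h : RWStep R u v) : g.Derives (markers D v) (markers D u) := by
  obtain ⟨x, y, l, r, hlr, rfl, rfl⟩ := h
  have hm := hmon _ hlr
  have hl : l ≠ [] := by
    rintro rfl
    simp at hm
  obtain ⟨a, rfl⟩ := exists_eq_toWord hm.2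
  rw [markers_of_ne_nil D (p := x ++ l ++ y) (by simp [hl])]
  have key := ((hrule a l hlr).append_left (x.map fun b => D (some b))).append_right
    (y.map fun b => D (some b))
  simp only [List.map_append]
  refine .trans ?_ key
  cases a with
  | some b =>
    rw [markers_of_ne_nil D (by simp [toWord])]
    simpa [toWord] using ContextFreeGrammar.Derives.refl _
  | none =>
    rcases y with _ | ⟨c, y⟩
    · rcases x.eq_nil_or_concat with rfl | ⟨x, c, rfl⟩
      · exact ContextFreeGrammar.Derives.refl [D none]
      · rw [markers_of_ne_nil D (by simp [toWord])]
        simpa [toWord] using (hright (some c)).append_left (x.map fun b => D (some b))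
    · rw [markers_of_ne_nil D (by simp [toWord])]
      simpa [toWord] using ((hleft (some c)).append_right
        (y.map fun b => D (some b))).append_left (x.map fun b => D (some b))

/-- If `u ⇒* p` then `D_p` derives `u`. -/
lemma derives_terminal_of_rwDerives {g : ContextFreeGrammar (Option A)}
    {D : Option A → Symbol (Option A) g.NT}
    (hmon : RWMonadic R)
    (hright : ∀ a, g.Derives [D a] [D a, D none])
    (hleft : ∀ a, g.Derives [D a] [D none, D a])
    (hrule : ∀ a l, (l, toWord a) ∈ R → g.Derives [D a] (l.map fun b => D (some b)))
    (hterm : ∀ a, g.Derives [D a] ((toWord a).map fun b => .terminal (some b)))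
    {u p : Word A} (h : RWDerives R u p) :
    g.Derives (markers D p) (u.map fun b => .terminal (some b)) := by
  induction h with
  | refl =>
    cases u with
    | nil => exact hterm none
    | cons b u =>
      have h := ContextFreeGrammar.derives_flatMap (fun b => hterm (some b)) (b :: u)
      simp only [toWord, Option.elim_some, List.map_singleton, ← List.map_eq_flatMap] at h
      exact h
  | tail _ h ih =>
    exact (derives_markers_of_rwStep hmon hright hleft hrule h).trans ih

end Completeness

section Soundness

variable {A : Type}

/-- The words over `A`, read over `A ∪ {#₂}`, which reduce to `p`. -/
def reducingTo (R : Set (Word A × Word A)) (p : Word A) : Language (Option A) :=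
  {x | ∃ w : Word A, x = w.map some ∧ RWDerives R w p}

variable {R : Set (Word A × Word A)}

lemma reducingTo_mul_le (p q : Word A) :
    reducingTo R p * reducingTo R q ≤ reducingTo R (p ++ q) := by
  intro x hx
  obtain ⟨_, ⟨u, rfl, hu⟩, _, ⟨v, rfl, hv⟩, rfl⟩ := Language.mem_mul.1 hx
  exact ⟨u ++ v, by simp, hu.append hv⟩

lemma prod_reducingTo_le (p : Word A) :
    (p.map fun b => reducingTo R (toWord (some b))).prod ≤ reducingTo R p := by
  induction p with
  | nil =>
    rintro x rfl
    exact ⟨[], rfl, .refl⟩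
  | cons b p ih =>
    rw [List.map_cons, List.prod_cons]
    exact (mul_le_mul_right ih _).trans (reducingTo_mul_le [b] p)

lemma prod_markers_reducingTo_le (p : Word A) :
    (markers (fun a => reducingTo R (toWord a)) p).prod ≤ reducingTo R p := by
  cases p with
  | nil => simp [markers, toWord]
  | cons b p => exact prod_reducingTo_le (b :: p)

lemma substLanguage_initial_le {g : ContextFreeGrammar A} {a : Option A}
    (hg : g.language = {l : Word A | (l, toWord a) ∈ R}) :
    g.substLanguage (fun b => reducingTo R (toWord (some b))) (.nonterminal g.initial) ≤
      reducingTo R (toWord a) := by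
  rintro x ⟨l, hl, hx⟩
  obtain ⟨w, rfl, hw⟩ := prod_reducingTo_le l hx
  have hl : l ∈ g.language := hl
  rw [hg] at hl
  exact ⟨w, rfl, hw.tail (.of_mem hl)⟩

lemma map_some_toWord_mem_reducingTo (a : Option A) :
    (toWord a).map some ∈ reducingTo R (toWord a) :=
  ⟨_, rfl, .refl⟩

/-- The interpretation of the terminals of `Δ`. -/
def dollarLanguage (R : Set (Word A × Word A)) : DollarT A → Language (Option A)
  | .dol a => reducingTo R (toWord a)
  | .tdol a => reducingTo (reverseSystem R) (toWord a)
  | .hash => {[none]}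

/-- The interpretation of the symbols of `Θ`. -/
def thetaLanguage (R : Set (Word A × Word A)) (Γ : Option A → ContextFreeGrammar.{0} A)
    (Δ : ContextFreeGrammar.{0} (DollarT A)) :
    Symbol (Option A) (ThetaNT A Γ Δ) → Language (Option A)
  | .terminal b => {[b]}
  | .nonterminal (.delta n) => Δ.substLanguage (dollarLanguage R) (.nonterminal n)
  | .nonterminal (.dol a) => reducingTo R (toWord a)
  | .nonterminal (.tdol a) => reducingTo (reverseSystem R) (toWord a)
  | .nonterminal (.prime a n) =>
    (Γ a).substLanguage (fun b => reducingTo R (toWord (some b))) (.nonterminal n)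
  | .nonterminal (.dprime a n) =>
    (Γ a).reverse.substLanguage (fun b => reducingTo (reverseSystem R) (toWord (some b)))
      (.nonterminal n)

lemma thetaLanguage_comp_deltaSym (Γ : Option A → ContextFreeGrammar.{0} A)
    (Δ : ContextFreeGrammar.{0} (DollarT A)) :
    thetaLanguage R Γ Δ ∘ deltaSym Γ Δ = Δ.substLanguage (dollarLanguage R) := by
  funext s
  rcases s with (_ | _ | _) | _ <;> rfl

lemma thetaLanguage_comp_primeSym (Γ : Option A → ContextFreeGrammar.{0} A)
    (Δ : ContextFreeGrammar.{0} (DollarT A)) (a : Option A) :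
    thetaLanguage R Γ Δ ∘ primeSym Γ Δ a =
      (Γ a).substLanguage fun b => reducingTo R (toWord (some b)) := by
  funext s
  cases s <;> rfl

lemma thetaLanguage_comp_dprimeSym (Γ : Option A → ContextFreeGrammar.{0} A)
    (Δ : ContextFreeGrammar.{0} (DollarT A)) (a : Option A) :
    thetaLanguage R Γ Δ ∘ dprimeSym Γ Δ a =
      (Γ a).reverse.substLanguage fun b => reducingTo (reverseSystem R) (toWord (some b)) := by
  funext s
  cases s <;> rfl

end Soundness

section Grammar

variable {A : Type} {R : Set (Word A × Word A)} {Γ : Option A → ContextFreeGrammar.{0} A}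
  {Δ : ContextFreeGrammar.{0} (DollarT A)}

lemma dW_eq_markers (p : Word A) : dW p = markers DollarT.dol p := by
  cases p <;> rfl

lemma tdW_eq_markers (p : Word A) : tdW p = markers DollarT.tdol p := by
  cases p <;> rfl

lemma language_reverse_eq {g : ContextFreeGrammar A} {a : Option A}
    (hg : g.language = {l : Word A | (l, toWord a) ∈ R}) :
    g.reverse.language = {l : Word A | (l, toWord a) ∈ reverseSystem R} := by
  rw [ContextFreeGrammar.language_reverse, hg]
  ext l
  change (l.reverse, toWord a) ∈ R ↔ (l.reverse, (toWord a).reverse) ∈ R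
  rw [reverse_toWord]

lemma mem_reverse_rules {g : ContextFreeGrammar A} {r : ContextFreeRule A g.NT}
    (hr : r ∈ g.rules) : r.reverse ∈ g.reverse.rules :=
  Finset.mem_map.2 ⟨r, hr, rfl⟩

variable [Fintype A]

lemma mem_rules_Theta {r : ContextFreeRule (Option A) (ThetaNT A Γ Δ)} :
    r ∈ (Theta Γ Δ).rules ↔ r ∈ thetaRules Γ Δ :=
  @List.mem_toFinset _ (Classical.decEq _) _ _

lemma Theta_derives {n : ThetaNT A Γ Δ} {s : List (Symbol (Option A) (ThetaNT A Γ Δ))}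
    (h : ⟨n, s⟩ ∈ thetaRules Γ Δ) : (Theta Γ Δ).Derives [.nonterminal n] s :=
  ContextFreeGrammar.derives_of_mem_rules (g := Theta Γ Δ) (r := ⟨n, s⟩) (mem_rules_Theta.2 h)

lemma Theta_derives_delta {s t : List (Symbol (DollarT A) Δ.NT)} (h : Δ.Derives s t)
    {s' t' : List (Symbol (Option A) (ThetaNT A Γ Δ))} (hs : s.map (deltaSym Γ Δ) = s')
    (ht : t.map (deltaSym Γ Δ) = t') : (Theta Γ Δ).Derives s' t' := by
  subst hs ht
  exact h.map_symbols (g' := Theta Γ Δ) fun r hr => Theta_derives (by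
    simp only [thetaRules, List.mem_append, List.mem_map, Finset.mem_toList]
    exact .inl ⟨r, hr, rfl⟩)

lemma Theta_derives_prime (a : Option A) {s t : List (Symbol A (Γ a).NT)}
    (h : (Γ a).Derives s t)
    {s' t' : List (Symbol (Option A) (ThetaNT A Γ Δ))} (hs : s.map (primeSym Γ Δ a) = s')
    (ht : t.map (primeSym Γ Δ a) = t') : (Theta Γ Δ).Derives s' t' := by
  subst hs ht
  exact h.map_symbols (g' := Theta Γ Δ) fun r hr => Theta_derives (by
    simp only [thetaRules, List.mem_append, List.mem_flatMap, List.mem_map, Finset.mem_toList]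
    exact .inr ⟨a, Finset.mem_univ a, .inl (.inl ⟨r, hr, rfl⟩)⟩)

lemma Theta_derives_dprime (a : Option A) {s t : List (Symbol A (Γ a).NT)}
    (h : (Γ a).reverse.Derives s t)
    {s' t' : List (Symbol (Option A) (ThetaNT A Γ Δ))} (hs : s.map (dprimeSym Γ Δ a) = s')
    (ht : t.map (dprimeSym Γ Δ a) = t') : (Theta Γ Δ).Derives s' t' := by
  subst hs ht
  exact h.map_symbols (g := (Γ a).reverse) (g' := Theta Γ Δ) fun r hr => by
    obtain ⟨r, hr', rfl⟩ := Finset.mem_map.1 hr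
    refine Theta_derives ?_
    simp only [thetaRules, List.mem_append, List.mem_flatMap, List.mem_map, Finset.mem_toList]
    exact .inr ⟨a, Finset.mem_univ a, .inl (.inr ⟨r, hr', rfl⟩)⟩

lemma mem_thetaRules_of_marker (a : Option A) {r : ContextFreeRule (Option A) (ThetaNT A Γ Δ)}
    (h : r ∈ ([
      ⟨.dol a, [.nonterminal (.dol a), .nonterminal (.dol none)]⟩,
      ⟨.dol a, [.nonterminal (.dol none), .nonterminal (.dol a)]⟩,
      ⟨.tdol a, [.nonterminal (.tdol a), .nonterminal (.tdol none)]⟩,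
      ⟨.tdol a, [.nonterminal (.tdol none), .nonterminal (.tdol a)]⟩,
      ⟨.dol a, [.nonterminal (.prime a (Γ a).initial)]⟩,
      ⟨.tdol a, [.nonterminal (.dprime a (Γ a).initial)]⟩,
      ⟨.dol a, (toWord a).map fun b => .terminal (some b)⟩,
      ⟨.tdol a, (toWord a).map fun b => .terminal (some b)⟩] :
        List (ContextFreeRule (Option A) (ThetaNT A Γ Δ)))) :
    r ∈ thetaRules Γ Δ :=
  List.mem_append_right _ (List.mem_flatMap.2
    ⟨a, Finset.mem_toList.2 (Finset.mem_univ a), List.mem_append_right _ h⟩)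

lemma Theta_derives_dol (hmon : RWMonadic R)
    (hΓ : ∀ a : Option A, (Γ a).language = {l : Word A | (l, toWord a) ∈ R})
    {u p : Word A} (h : RWDerives R u p) :
    (Theta Γ Δ).Derives (markers (fun a => .nonterminal (.dol a)) p)
      (u.map fun b => .terminal (some b)) := by
  refine derives_terminal_of_rwDerives hmon
    (fun a => Theta_derives (mem_thetaRules_of_marker a (List.mem_of_getElem? (i := 0) rfl)))
    (fun a => Theta_derives (mem_thetaRules_of_marker a (List.mem_of_getElem? (i := 1) rfl)))
    (fun a l hl => ?_)
    (fun a => Theta_derives (mem_thetaRules_of_marker a (List.mem_of_getElem? (i := 6) rfl))) h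
  have hl : l ∈ (Γ a).language := by rwa [hΓ a]
  refine (Theta_derives (s := [.nonterminal (.prime a (Γ a).initial)])
    (mem_thetaRules_of_marker a (List.mem_of_getElem? (i := 4) rfl))).trans ?_
  exact Theta_derives_prime a hl rfl List.map_map

lemma Theta_derives_tdol (hmon : RWMonadic R)
    (hΓ : ∀ a : Option A, (Γ a).language = {l : Word A | (l, toWord a) ∈ R})
    {u p : Word A} (h : RWDerives (reverseSystem R) u p) :
    (Theta Γ Δ).Derives (markers (fun a => .nonterminal (.tdol a)) p)
      (u.map fun b => .terminal (some b)) := by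
  refine derives_terminal_of_rwDerives hmon.reverseSystem
    (fun a => Theta_derives (mem_thetaRules_of_marker a (List.mem_of_getElem? (i := 2) rfl)))
    (fun a => Theta_derives (mem_thetaRules_of_marker a (List.mem_of_getElem? (i := 3) rfl)))
    (fun a l hl => ?_)
    (fun a => Theta_derives (mem_thetaRules_of_marker a (List.mem_of_getElem? (i := 7) rfl))) h
  have hl : l ∈ (Γ a).reverse.language := by rwa [language_reverse_eq (hΓ a)]
  refine (Theta_derives (s := [.nonterminal (.dprime a (Γ a).initial)])
    (mem_thetaRules_of_marker a (List.mem_of_getElem? (i := 5) rfl))).trans ?_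
  exact Theta_derives_dprime a hl rfl List.map_map

lemma prod_thetaLanguage_le
    (hΓ : ∀ a : Option A, (Γ a).language = {l : Word A | (l, toWord a) ∈ R})
    {r : ContextFreeRule (Option A) (ThetaNT A Γ Δ)} (hr : r ∈ thetaRules Γ Δ) :
    (r.output.map (thetaLanguage R Γ Δ)).prod ≤ thetaLanguage R Γ Δ (.nonterminal r.input) := by
  have hterm (a : Option A) (S : Set (Word A × Word A)) :
      (((toWord a).map fun b => Symbol.terminal (some b)).map (thetaLanguage R Γ Δ)).prod ≤
        reducingTo S (toWord a) := by
    rintro x hx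
    suffices x = (toWord a).map some from this ▸ map_some_toWord_mem_reducingTo a
    cases a with
    | none => exact hx
    | some b => exact (List.prod_singleton (x := ({[some b]} : Language (Option A)))).le hx
  simp only [thetaRules, List.mem_append, List.mem_flatMap, List.mem_map, Finset.mem_toList,
    Finset.mem_univ, true_and, List.mem_cons, List.not_mem_nil, or_false] at hr
  obtain ⟨r, hr, rfl⟩ | ⟨a, (⟨r, hr, rfl⟩ | ⟨r, hr, rfl⟩) |
    (rfl | rfl | rfl | rfl | rfl | rfl | rfl | rfl)⟩ := hr
  · rw [List.map_map, thetaLanguage_comp_deltaSym]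
    exact Δ.prod_substLanguage_le _ hr
  · rw [List.map_map, thetaLanguage_comp_primeSym]
    exact (Γ a).prod_substLanguage_le _ hr
  · rw [List.map_map, thetaLanguage_comp_dprimeSym]
    exact (Γ a).reverse.prod_substLanguage_le _ (mem_reverse_rules hr)
  · simpa [thetaLanguage, toWord] using reducingTo_mul_le (R := R) (toWord a) []
  · simpa [thetaLanguage, toWord] using reducingTo_mul_le (R := R) [] (toWord a)
  · simpa [thetaLanguage, toWord] using
      reducingTo_mul_le (R := reverseSystem R) (toWord a) []
  · simpa [thetaLanguage, toWord] using
      reducingTo_mul_le (R := reverseSystem R) [] (toWord a)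
  · simpa [thetaLanguage] using substLanguage_initial_le (hΓ a)
  · simpa [thetaLanguage] using substLanguage_initial_le (language_reverse_eq (hΓ a))
  · exact hterm a R
  · exact hterm a (reverseSystem R)

end Grammar

/-- **Lemma** (conclusion of the proof of Theorem 3.1)**.** The language generated by
`Θ` equals `K = { u #₂ vʳᵉᵛ : u, v ∈ A*, u =_M v }`; in particular, `K` is
context-free. Here `#₂` is encoded as `none : Option A`. -/
theorem language_Theta_eq_K
    {A : Type} [Fintype A] (R : Set (Word A × Word A))
    (hconf : RWConfluent R) (hmon : RWMonadic R)
    (Γ : Option A → ContextFreeGrammar.{0} A)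
    (hΓ : ∀ a : Option A, (Γ a).language = {l : Word A | (l, toWord a) ∈ R})
    (hΓeps : ∀ a : Option A, ∀ r ∈ (Γ a).rules, r.output ≠ [])
    (Δ : ContextFreeGrammar.{0} (DollarT A))
    (hΔ : Δ.language =
      {x | ∃ p : Word A, x = dW p ++ [DollarT.hash] ++ tdW p.reverse}) :
    (Theta Γ Δ).language =
      {x : List (Option A) | ∃ u v : Word A,
        x = u.map some ++ [none] ++ (v.map some).reverse ∧ MonEq R u v} ∧
    Language.IsContextFree
      {x : List (Option A) | ∃ u v : Word A,
        x = u.map some ++ [none] ++ (v.map some).reverse ∧ MonEq R u v} := by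
  have h : (Theta Γ Δ).language = {x : List (Option A) | ∃ u v : Word A,
      x = u.map some ++ [none] ++ (v.map some).reverse ∧ MonEq R u v} := by
    refine Set.Subset.antisymm ?_ ?_
    · intro x hx
      have hle := ContextFreeGrammar.Derives.prod_le (g := Theta Γ Δ) (I := thetaLanguage R Γ Δ)
        (fun r hr => prod_thetaLanguage_le hΓ (mem_rules_Theta.1 hr)) hx
      have hx' : x ∈ [thetaLanguage R Γ Δ (.nonterminal (.delta Δ.initial))].prod :=
        hle (ContextFreeGrammar.mem_prod_terminal _ _ (fun _ => rfl) x)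
      rw [List.prod_singleton] at hx'
      obtain ⟨y, hy, hxy⟩ := hx'
      have hy : y ∈ Δ.language := hy
      rw [hΔ] at hy
      obtain ⟨p, rfl⟩ := hy
      rw [dW_eq_markers, tdW_eq_markers, List.map_append, List.map_append, map_markers,
        map_markers, List.prod_append, List.prod_append, List.map_singleton,
        List.prod_singleton] at hxy
      obtain ⟨_, hl, _, hr, rfl⟩ := Language.mem_mul.1 hxy
      obtain ⟨_, hl₁, _, rfl, rfl⟩ := Language.mem_mul.1 hl
      obtain ⟨u, rfl, hu⟩ : _ ∈ reducingTo R p := prod_markers_reducingTo_le p hl₁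
      obtain ⟨v, rfl, hv⟩ : _ ∈ reducingTo (reverseSystem R) p.reverse :=
        prod_markers_reducingTo_le p.reverse hr
      have hv := hv.reverse
      rw [reverseSystem_reverseSystem, List.reverse_reverse] at hv
      exact ⟨u, v.reverse, by simp, hu.monEq.trans _ _ _ (hv.monEq.symm _ _)⟩
    · rintro _ ⟨u, v, rfl, huv⟩
      obtain ⟨p, hu, hv⟩ := hconf.exists_common huv
      have hp : dW p ++ [DollarT.hash] ++ tdW p.reverse ∈ Δ.language := by
        rw [hΔ]
        exact ⟨p, rfl⟩
      have h₁ : ((dW p ++ [DollarT.hash] ++ tdW p.reverse).map Symbol.terminal).map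
          (deltaSym Γ Δ) = markers (fun a => .nonterminal (.dol a)) p ++ [.terminal none] ++
            markers (fun a => .nonterminal (.tdol a)) p.reverse := by
        simp only [dW_eq_markers, tdW_eq_markers, List.map_append, map_markers]
        rfl
      have h₂ : (u.map some ++ [none] ++ (v.map some).reverse).map
          (Symbol.terminal (N := (Theta Γ Δ).NT)) = (u.map fun b => .terminal (some b)) ++
            [.terminal none] ++ v.reverse.map fun b => .terminal (some b) := by
        simp [Function.comp_def]
      refine (Theta_derives_delta hp rfl h₁).trans ?_
      rw [h₂]
      exact ((Theta_derives_dol hmon hΓ hu).append_right [.terminal none]).append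
        (Theta_derives_tdol hmon hΓ hv.reverse)
  exact ⟨h, Theta Γ Δ, h⟩
end
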